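/- For every c ∈ ℝ and all real numbers a < b with the interval (a,b) contained in (K₂,K₁), there exists t ∈ (a,b) such that 4·μ''(t)·μ(t)·(t−c)² + 4·(μ'(t))²·(t−c)² + 2·μ'(t)·μ(t)·(t−c) − μ(t)² ≠ 0. In other words, the identity 4μ''μ(K−c)² + 4(μ')²(K−c)² + 2μ'μ(K−c) − μ² = 0 cannot hold on any nondegenerate subinterval of (K₂,K₁). (The key non-vanishing claim in the proof of Lemma 3.3.) -/

import Mathlib

/-- The function `μ(t) = √(−(4/3)(t−K₁)(t−K₂)(t+K₁+K₂))`. -/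
noncomputable def mu (K₁ K₂ t : ℝ) : ℝ :=
  Real.sqrt (-(4 / 3) * (t - K₁) * (t - K₂) * (t + K₁ + K₂))

/-- The radicand of `mu` is positive on `(K₂, K₁)`. -/
theorem mu_radicand_pos {K₁ K₂ t : ℝ} (hK₂ : -(K₁ + K₂) ≤ K₂) (ht : t ∈ Set.Ioo K₂ K₁) :
    0 < -(4 / 3) * (t - K₁) * (t - K₂) * (t + K₁ + K₂) := by
  obtain ⟨h2, h1⟩ := ht
  have h : 0 < (K₁ - t) * (t - K₂) * (t + K₁ + K₂) :=
    mul_pos (mul_pos (by linarith) (by linarith)) (by linarith)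
  linarith

/-- The radicand of `mu` has no quadratic term. -/
theorem hasDerivAt_mu_radicand (K₁ K₂ t : ℝ) :
    HasDerivAt (fun t : ℝ => -(4 / 3) * (t - K₁) * (t - K₂) * (t + K₁ + K₂))
      (-4 * t ^ 2 + 4 / 3 * (K₁ ^ 2 + K₁ * K₂ + K₂ ^ 2)) t := by
  have h := (((((hasDerivAt_id t).sub_const K₁).const_mul (-(4 / 3) : ℝ)).mul
    ((hasDerivAt_id t).sub_const K₂)).mul (((hasDerivAt_id t).add_const K₁).add_const K₂))
  refine h.congr_deriv ?_
  simp only [id, Pi.mul_apply]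
  ring

theorem hasDerivAt_mu {K₁ K₂ t : ℝ} (hK₂ : -(K₁ + K₂) ≤ K₂) (ht : t ∈ Set.Ioo K₂ K₁) :
    HasDerivAt (mu K₁ K₂)
      ((-4 * t ^ 2 + 4 / 3 * (K₁ ^ 2 + K₁ * K₂ + K₂ ^ 2)) / (2 * mu K₁ K₂ t)) t :=
  (hasDerivAt_mu_radicand K₁ K₂ t).sqrt (mu_radicand_pos hK₂ ht).ne'

theorem hasDerivAt_deriv_mu {K₁ K₂ t : ℝ} (hK₂ : -(K₁ + K₂) ≤ K₂) (ht : t ∈ Set.Ioo K₂ K₁) :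
    HasDerivAt (deriv (mu K₁ K₂))
      ((-8 * t * (2 * mu K₁ K₂ t) -
        (-4 * t ^ 2 + 4 / 3 * (K₁ ^ 2 + K₁ * K₂ + K₂ ^ 2)) * (2 * deriv (mu K₁ K₂) t)) /
          (2 * mu K₁ K₂ t) ^ 2) t := by
  have hμ : 2 * mu K₁ K₂ t ≠ 0 :=
    mul_ne_zero two_ne_zero (Real.sqrt_pos.2 (mu_radicand_pos hK₂ ht)).ne'
  have hnum : HasDerivAt (fun t : ℝ => -4 * t ^ 2 + 4 / 3 * (K₁ ^ 2 + K₁ * K₂ + K₂ ^ 2))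
      (-8 * t) t := by
    refine (((hasDerivAt_pow 2 t).const_mul (-4 : ℝ)).add_const _).congr_deriv ?_
    norm_num
    ring
  have hden := (hasDerivAt_mu hK₂ ht).differentiableAt.hasDerivAt.const_mul (2 : ℝ)
  refine (hnum.div hden hμ).congr_of_eventuallyEq ?_
  filter_upwards [Ioo_mem_nhds ht.1 ht.2] with s hs
  exact (hasDerivAt_mu hK₂ hs).deriv

/-- In terms of the cubic `p = μ²`, the expression is `2p''(t−c)² + p'(t−c) − p`. -/
theorem mu_expression_eq_cubic {K₁ K₂ t : ℝ} (c : ℝ) (hK₂ : -(K₁ + K₂) ≤ K₂)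
    (ht : t ∈ Set.Ioo K₂ K₁) :
    4 * deriv (deriv (mu K₁ K₂)) t * mu K₁ K₂ t * (t - c) ^ 2 +
        4 * (deriv (mu K₁ K₂) t) ^ 2 * (t - c) ^ 2 +
        2 * deriv (mu K₁ K₂) t * mu K₁ K₂ t * (t - c) - (mu K₁ K₂ t) ^ 2 =
      2 * (-8 * t) * (t - c) ^ 2 +
        (-4 * t ^ 2 + 4 / 3 * (K₁ ^ 2 + K₁ * K₂ + K₂ ^ 2)) * (t - c) -
        -(4 / 3) * (t - K₁) * (t - K₂) * (t + K₁ + K₂) := by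
  have hμ : mu K₁ K₂ t ≠ 0 := (Real.sqrt_pos.2 (mu_radicand_pos hK₂ ht)).ne'
  have hsq : mu K₁ K₂ t ^ 2 = -(4 / 3) * (t - K₁) * (t - K₂) * (t + K₁ + K₂) :=
    Real.sq_sqrt (mu_radicand_pos hK₂ ht).le
  rw [← hsq, (hasDerivAt_deriv_mu hK₂ ht).deriv, (hasDerivAt_mu hK₂ ht).deriv]
  field_simp
  ring

/-- The identity `4μ''μ(K−c)² + 4(μ')²(K−c)² + 2μ'μ(K−c) − μ² = 0`
cannot hold on any nondegenerate subinterval of `(K₂, K₁)`. -/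
theorem key_nonvanishing
    (K₁ K₂ : ℝ) (hK₁ : 0 < K₁) (hK₁₂ : K₂ < K₁) (hK₂ : -(K₁ + K₂) ≤ K₂)
    (c : ℝ) (a b : ℝ) (hab : a < b) (hsub : Set.Ioo a b ⊆ Set.Ioo K₂ K₁) :
    ∃ t ∈ Set.Ioo a b,
      4 * deriv (deriv (mu K₁ K₂)) t * mu K₁ K₂ t * (t - c) ^ 2 +
        4 * (deriv (mu K₁ K₂) t) ^ 2 * (t - c) ^ 2 +
        2 * deriv (mu K₁ K₂) t * mu K₁ K₂ t * (t - c) -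
        (mu K₁ K₂ t) ^ 2 ≠ 0 := by
  by_contra! hzero
  have hcubic : ∀ t ∈ Set.Ioo a b, 2 * (-8 * t) * (t - c) ^ 2 +
      (-4 * t ^ 2 + 4 / 3 * (K₁ ^ 2 + K₁ * K₂ + K₂ ^ 2)) * (t - c) -
      -(4 / 3) * (t - K₁) * (t - K₂) * (t + K₁ + K₂) = 0 := fun t ht =>
    (mu_expression_eq_cubic c hK₂ (hsub ht)).symm.trans (hzero t ht)
  -- The third difference of the cubic with step `h` is `-112 * h ^ 3`.
  obtain ⟨h, hh, rfl⟩ : ∃ h : ℝ, 0 < h ∧ b = a + 5 * h := ⟨(b - a) / 5, by linarith, by ring⟩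
  have e₁ := hcubic (a + h) ⟨by linarith, by linarith⟩
  have e₂ := hcubic (a + 2 * h) ⟨by linarith, by linarith⟩
  have e₃ := hcubic (a + 3 * h) ⟨by linarith, by linarith⟩
  have e₄ := hcubic (a + 4 * h) ⟨by linarith, by linarith⟩
  have hpos : 0 < h ^ 3 := pow_pos hh 3
  have hdiff : -112 * h ^ 3 = 0 := by linear_combination e₄ - 3 * e₃ + 3 * e₂ - e₁
  linarith
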